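/- Let P be a full-support joint distribution on Ω, fix a linear order on ι and a parent assignment (Π_i)_{i∈ι}, and let Q be the Bayesian projection of P with respect to (Π_i). Then the cross entropy of P relative to Q decomposes into a sum of conditional entropies of P: − Σ_{x ∈ Ω} P(x) log Q(x) = Σ_{i ∈ ι} H({i} | Π_i). -/

import Mathlib

open scoped BigOperators

namespace CausalPre

variable {ι : Type*} [Fintype ι] [DecidableEq ι]
variable {F : ι → Type*} [∀ i, Fintype (F i)] [∀ i, DecidableEq (F i)]
  [∀ i, Nonempty (F i)]

/-- Restriction of a full configuration to the coordinates in `S`. -/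
def restrict (S : Finset ι) (x : ∀ i, F i) : ∀ i : S, F i := fun i => x i

/-- `P` is a joint distribution on `Ω = Π i, F i`. -/
def IsJoint (P : (∀ i, F i) → ℝ) : Prop :=
  (∀ x, 0 ≤ P x) ∧ ∑ x, P x = 1

/-- `P` has full support. -/
def FullSupport (P : (∀ i, F i) → ℝ) : Prop := ∀ x, 0 < P x

/-- Marginal of `P` on the coordinates in `S`. -/
noncomputable def marginal (P : (∀ i, F i) → ℝ) (S : Finset ι)
    (s : ∀ i : S, F i) : ℝ :=
  ∑ x : ∀ i, F i, if restrict S x = s then P x else 0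

/-- Conditional probability `P[T | S]`, evaluated at the restrictions of a full
configuration `x`:  `P[T | S](x_T | x_S) = P_{S ∪ T}(x_{S ∪ T}) / P_S(x_S)`. -/
noncomputable def condProb (P : (∀ i, F i) → ℝ) (T S : Finset ι)
    (x : ∀ i, F i) : ℝ :=
  marginal P (S ∪ T) (restrict (S ∪ T) x) / marginal P S (restrict S x)

/-- Entropy of the marginal of `P` on `S`. -/
noncomputable def entropy (P : (∀ i, F i) → ℝ) (S : Finset ι) : ℝ :=
  -∑ s : ∀ i : S, F i, marginal P S s * Real.log (marginal P S s)

/-- Mutual information `I(S ; T)` of disjoint `S`, `T`. -/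
noncomputable def mutualInfo (P : (∀ i, F i) → ℝ) (S T : Finset ι) : ℝ :=
  entropy P S + entropy P T - entropy P (S ∪ T)

/-- Conditional entropy `H(S | T)` for disjoint `S`, `T`. -/
noncomputable def condEntropy (P : (∀ i, F i) → ℝ) (S T : Finset ι) : ℝ :=
  entropy P (S ∪ T) - entropy P T

/-- Conditional mutual information `I(S ; T | U)` of pairwise disjoint `S`, `T`, `U`. -/
noncomputable def condMutualInfo (P : (∀ i, F i) → ℝ) (S T U : Finset ι) : ℝ :=
  entropy P (S ∪ U) + entropy P (T ∪ U) - entropy P (S ∪ T ∪ U) - entropy P U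

/-- Kullback–Leibler divergence `D_KL(P ‖ Q) = Σ_{x : P(x) > 0} P(x) log (P(x)/Q(x))`. -/
noncomputable def klDiv (P Q : (∀ i, F i) → ℝ) : ℝ :=
  ∑ x, if 0 < P x then P x * Real.log (P x / Q x) else 0

variable [LinearOrder ι]

/-- A parent assignment with respect to a linear order: `Pa i ⊆ {j : j < i}`. -/
def IsParentAssignment (Pa : ι → Finset ι) : Prop :=
  ∀ i, ∀ j ∈ Pa i, j < i

/-- Bayesian projection of `P` with respect to a parent assignment:
`Q(x) = Π_i P[{i} | Pa i](x_i | x_{Pa i})`. -/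
noncomputable def bayesProj (P : (∀ i, F i) → ℝ) (Pa : ι → Finset ι)
    (x : ∀ i, F i) : ℝ :=
  ∏ i, condProb P {i} (Pa i) x

/-- Expectation of `g` under the marginal on `S`, computed on the full configuration space. -/
theorem sum_marginal_mul (P : (∀ i, F i) → ℝ) (S : Finset ι) (g : (∀ i : S, F i) → ℝ) :
    ∑ s, marginal P S s * g s = ∑ x, P x * g (restrict S x) := by
  simp only [marginal, Finset.sum_mul, ite_mul, zero_mul]
  rw [Finset.sum_comm]
  simp

theorem entropy_eq_neg_sum (P : (∀ i, F i) → ℝ) (S : Finset ι) :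
    entropy P S = -∑ x, P x * Real.log (marginal P S (restrict S x)) := by
  rw [entropy, sum_marginal_mul P S fun s => Real.log (marginal P S s)]

theorem marginal_restrict_pos {P : (∀ i, F i) → ℝ} (hfull : FullSupport P) (S : Finset ι)
    (x : ∀ i, F i) : 0 < marginal P S (restrict S x) := by
  refine Finset.sum_pos' (fun y _ => ?_) ⟨x, Finset.mem_univ x, by simpa using hfull x⟩
  split_ifs
  exacts [(hfull y).le, le_rfl]

theorem condProb_pos {P : (∀ i, F i) → ℝ} (hfull : FullSupport P) (T S : Finset ι)
    (x : ∀ i, F i) : 0 < condProb P T S x :=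
  div_pos (marginal_restrict_pos hfull _ x) (marginal_restrict_pos hfull _ x)

theorem condEntropy_eq_neg_sum {P : (∀ i, F i) → ℝ} (hfull : FullSupport P) (T S : Finset ι) :
    condEntropy P T S = -∑ x, P x * Real.log (condProb P T S x) := by
  have hlog (x : ∀ i, F i) : Real.log (condProb P T S x) =
      Real.log (marginal P (S ∪ T) (restrict (S ∪ T) x)) -
        Real.log (marginal P S (restrict S x)) :=
    Real.log_div (marginal_restrict_pos hfull _ x).ne' (marginal_restrict_pos hfull _ x).ne'
  simp only [hlog, mul_sub, Finset.sum_sub_distrib]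
  rw [condEntropy, Finset.union_comm T S, entropy_eq_neg_sum, entropy_eq_neg_sum]
  ring

/-- For a full-support joint distribution `P`, a parent
assignment `Pa` and its Bayesian projection `Q`, the cross entropy of `P`
relative to `Q` decomposes into a sum of conditional entropies of `P`:
`− Σ_x P(x) log Q(x) = Σ_i H({i} | Pa i)`. -/
theorem crossEntropy_bayesProj_eq_sum_condEntropy
    (P : (∀ i, F i) → ℝ) (hP : IsJoint P) (hfull : FullSupport P)
    (Pa : ι → Finset ι) (hPa : IsParentAssignment Pa) :
    -∑ x : ∀ i, F i, P x * Real.log (bayesProj P Pa x)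
      = ∑ i, condEntropy P {i} (Pa i) := by
  have hlog (x : ∀ i, F i) :
      Real.log (bayesProj P Pa x) = ∑ i, Real.log (condProb P {i} (Pa i) x) :=
    Real.log_prod fun i _ => (condProb_pos hfull {i} (Pa i) x).ne'
  simp only [hlog, Finset.mul_sum, condEntropy_eq_neg_sum hfull, Finset.sum_neg_distrib]
  rw [Finset.sum_comm]

end CausalPre
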